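/- arXiv:2112.15430 — 3 statements merged into one kernel-verified Lean document; each statement's English description precedes it below -/
import Mathlib

section
/- Let α ∈ (0,1) and let ν be a probability measure on ℝ with bounded support, with quantile function F⁻¹. Then there exists a unique pair (θ₁*, θ₂*) ∈ ℝ² with θ₁* ≤ θ₂* minimizing, over all pairs (θ₁, θ₂) with θ₁ ≤ θ₂, the squared 2-Wasserstein approximation error W₂(ν, αδ_{θ₁} + (1−α)δ_{θ₂})² = ∫₀^α (F⁻¹(τ) − θ₁)² dτ + ∫_α^1 (F⁻¹(τ) − θ₂)² dτ, and this minimizer is given by θ₁* = AVaR^left_α(ν) and θ₂* = AVaR^right_{1−α}(ν). -/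
open MeasureTheory ProbabilityTheory Finset Set

noncomputable section

/-- Quantile (generalized inverse distribution) function of a measure on `ℝ`. -/
def quantileFn (ν : Measure ℝ) (τ : ℝ) : ℝ :=
  sInf {z : ℝ | τ ≤ cdf ν z}

/-- Left average value-at-risk at level `α`. -/
def avarLeft (α : ℝ) (ν : Measure ℝ) : ℝ :=
  (1 / α) * ∫ τ in (0:ℝ)..α, quantileFn ν τ

/-- Right average value-at-risk at level `1 - α`. -/
def avarRight (α : ℝ) (ν : Measure ℝ) : ℝ :=
  (1 / (1 - α)) * ∫ τ in α..(1:ℝ), quantileFn ν τ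

/-- A measure on `ℝ` with bounded support. -/
def HasBoundedSupport (ν : Measure ℝ) : Prop :=
  ∃ a b : ℝ, ν (Set.Icc a b)ᶜ = 0

/-- Squared 2-Wasserstein error between `ν` and the diatomic distribution
`α δ_{θ₁} + (1-α) δ_{θ₂}` (with `θ₁ ≤ θ₂`), expressed via quantile functions. -/
def W2errSq (α : ℝ) (ν : Measure ℝ) (θ : ℝ × ℝ) : ℝ :=
  (∫ τ in (0:ℝ)..α, (quantileFn ν τ - θ.1) ^ 2)
    + ∫ τ in α..(1:ℝ), (quantileFn ν τ - θ.2) ^ 2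

/-- The mean minimizes the quadratic error on an interval, with an explicit excess. -/
theorem integral_sub_sq_eq_add_sq {f : ℝ → ℝ} {u v m : ℝ} (t : ℝ)
    (hf : IntervalIntegrable f volume u v)
    (hf2 : IntervalIntegrable (fun x => f x ^ 2) volume u v)
    (hm : ∫ x in u..v, f x = (v - u) * m) :
    ∫ x in u..v, (f x - t) ^ 2 = (∫ x in u..v, (f x - m) ^ 2) + (v - u) * (m - t) ^ 2 := by
  have expand (s : ℝ) : ∫ x in u..v, (f x - s) ^ 2 =
      (∫ x in u..v, f x ^ 2) - 2 * s * ((v - u) * m) + (v - u) * s ^ 2 := by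
    have h : (fun x => (f x - s) ^ 2) = fun x => f x ^ 2 - 2 * s * f x + s ^ 2 := by
      ext x
      ring
    rw [h, intervalIntegral.integral_add (hf2.sub (hf.const_mul _)) intervalIntegrable_const,
      intervalIntegral.integral_sub hf2 (hf.const_mul _), intervalIntegral.integral_const_mul, hm,
      intervalIntegral.integral_const, smul_eq_mul]
  rw [expand, expand]
  ring

theorem cdf_eq_zero_of_lt {ν : Measure ℝ} [IsProbabilityMeasure ν] {a b z : ℝ}
    (h : ν (Set.Icc a b)ᶜ = 0) (hz : z < a) : cdf ν z = 0 := by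
  rw [cdf_eq_real, Measure.real, measure_mono_null _ h, ENNReal.toReal_zero]
  exact fun x hx hx' => (hx.trans_lt hz).not_ge hx'.1

theorem cdf_eq_one_of_le {ν : Measure ℝ} [IsProbabilityMeasure ν] {a b z : ℝ}
    (h : ν (Set.Icc a b)ᶜ = 0) (hz : b ≤ z) : cdf ν z = 1 := by
  have hIic : ν (Set.Iic z)ᶜ = 0 :=
    measure_mono_null (compl_subset_compl.2 fun x hx => hx.2.trans hz) h
  rw [cdf_eq_real, Measure.real, (prob_compl_eq_zero_iff measurableSet_Iic).1 hIic,
    ENNReal.toReal_one]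

theorem le_of_le_cdf {ν : Measure ℝ} [IsProbabilityMeasure ν] {a b z τ : ℝ}
    (h : ν (Set.Icc a b)ᶜ = 0) (hτ : 0 < τ) (hz : τ ≤ cdf ν z) : a ≤ z := by
  by_contra! hza
  rw [cdf_eq_zero_of_lt h hza] at hz
  exact hτ.not_ge hz

theorem quantileFn_mem_Icc {ν : Measure ℝ} [IsProbabilityMeasure ν] {a b τ : ℝ}
    (h : ν (Set.Icc a b)ᶜ = 0) (hτ : τ ∈ Set.Ioc 0 1) : quantileFn ν τ ∈ Set.Icc a b := by
  have hb : τ ≤ cdf ν b := (cdf_eq_one_of_le h le_rfl).symm ▸ hτ.2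
  exact ⟨le_csInf ⟨b, hb⟩ fun z hz => le_of_le_cdf h hτ.1 hz,
    csInf_le ⟨a, fun z hz => le_of_le_cdf h hτ.1 hz⟩ hb⟩

theorem monotoneOn_quantileFn {ν : Measure ℝ} [IsProbabilityMeasure ν]
    (h : HasBoundedSupport ν) : MonotoneOn (quantileFn ν) (Set.Ioc 0 1) := by
  obtain ⟨a, b, h⟩ := h
  intro s hs t ht hst
  exact csInf_le_csInf ⟨a, fun z hz => le_of_le_cdf h hs.1 hz⟩
    ⟨b, show t ≤ cdf ν b from (cdf_eq_one_of_le h le_rfl).symm ▸ ht.2⟩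
    fun z hz => hst.trans hz

theorem intervalIntegrable_quantileFn_pow {ν : Measure ℝ} [IsProbabilityMeasure ν]
    (h : HasBoundedSupport ν) (n : ℕ) {u v : ℝ} (hu : 0 ≤ u) (huv : u ≤ v) (hv : v ≤ 1) :
    IntervalIntegrable (fun τ => quantileFn ν τ ^ n) volume u v := by
  have hsub : Set.Ioc u v ⊆ Set.Ioc 0 1 := Set.Ioc_subset_Ioc hu hv
  have hmeas := aemeasurable_restrict_of_monotoneOn (μ := volume) measurableSet_Ioc
    ((monotoneOn_quantileFn h).mono hsub)
  obtain ⟨a, b, h⟩ := h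
  rw [intervalIntegrable_iff_integrableOn_Ioc_of_le huv]
  refine Integrable.of_bound (hmeas.pow_const n).aestronglyMeasurable (max |a| |b| ^ n) ?_
  filter_upwards [ae_restrict_mem measurableSet_Ioc] with τ hτ
  have hq := quantileFn_mem_Icc h (hsub hτ)
  rw [norm_pow, Real.norm_eq_abs]
  gcongr
  exact abs_le_max_abs_abs hq.1 hq.2

theorem W2errSq_eq_add_sq {α : ℝ} (hα : α ∈ Set.Ioo (0:ℝ) 1) {ν : Measure ℝ}
    [IsProbabilityMeasure ν] (h : HasBoundedSupport ν) (θ : ℝ × ℝ) :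
    W2errSq α ν θ = W2errSq α ν (avarLeft α ν, avarRight α ν) +
      (α * (avarLeft α ν - θ.1) ^ 2 + (1 - α) * (avarRight α ν - θ.2) ^ 2) := by
  have h0 : α ≠ 0 := hα.1.ne'
  have h1 : 1 - α ≠ 0 := (sub_pos.2 hα.2).ne'
  have hl (n : ℕ) := intervalIntegrable_quantileFn_pow h n le_rfl hα.1.le hα.2.le
  have hr (n : ℕ) := intervalIntegrable_quantileFn_pow h n hα.1.le hα.2.le le_rfl
  have el := integral_sub_sq_eq_add_sq (m := avarLeft α ν) θ.1 (by simpa using hl 1) (hl 2)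
    (by rw [avarLeft]; field_simp; ring)
  have er := integral_sub_sq_eq_add_sq (m := avarRight α ν) θ.2 (by simpa using hr 1) (hr 2)
    (by rw [avarRight]; field_simp)
  rw [W2errSq, W2errSq, el, er]
  ring

theorem avarLeft_le_avarRight {α : ℝ} (hα : α ∈ Set.Ioo (0:ℝ) 1) {ν : Measure ℝ}
    [IsProbabilityMeasure ν] (h : HasBoundedSupport ν) : avarLeft α ν ≤ avarRight α ν := by
  have h1 : 0 < 1 - α := sub_pos.2 hα.2
  have hl := intervalIntegrable_quantileFn_pow h 1 le_rfl hα.1.le hα.2.le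
  have hr := intervalIntegrable_quantileFn_pow h 1 hα.1.le hα.2.le le_rfl
  simp only [pow_one] at hl hr
  have hmono := monotoneOn_quantileFn h
  have hmem : α ∈ Set.Ioc (0:ℝ) 1 := ⟨hα.1, hα.2.le⟩
  have el := intervalIntegral.integral_mono_on_of_le_Ioo hα.1.le hl
    (intervalIntegrable_const (c := quantileFn ν α))
    fun x hx => hmono ⟨hx.1, (hx.2.trans hα.2).le⟩ hmem hx.2.le
  have er := intervalIntegral.integral_mono_on_of_le_Ioo hα.2.le
    (intervalIntegrable_const (c := quantileFn ν α)) hr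
    fun x hx => hmono hmem ⟨hα.1.trans hx.1, hx.2.le⟩ hx.1.le
  rw [intervalIntegral.integral_const, smul_eq_mul] at el er
  calc avarLeft α ν ≤ quantileFn ν α := by
        rw [avarLeft, one_div, inv_mul_le_iff₀ hα.1]
        simpa using el
    _ ≤ avarRight α ν := by
        rw [avarRight, one_div, le_inv_mul_iff₀ h1]
        exact er

theorem stmt0 (α : ℝ) (hα : α ∈ Set.Ioo (0:ℝ) 1)
    (ν : Measure ℝ) [IsProbabilityMeasure ν] (hb : HasBoundedSupport ν) :
    (∃! θ : ℝ × ℝ, θ.1 ≤ θ.2 ∧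
        ∀ θ' : ℝ × ℝ, θ'.1 ≤ θ'.2 → W2errSq α ν θ ≤ W2errSq α ν θ') ∧
    (avarLeft α ν ≤ avarRight α ν ∧
      ∀ θ' : ℝ × ℝ, θ'.1 ≤ θ'.2 →
        W2errSq α ν (avarLeft α ν, avarRight α ν) ≤ W2errSq α ν θ') := by
  have h0 : 0 < α := hα.1
  have h1 : 0 < 1 - α := sub_pos.2 hα.2
  have hle := avarLeft_le_avarRight hα hb
  have hmin (θ' : ℝ × ℝ) : W2errSq α ν (avarLeft α ν, avarRight α ν) ≤ W2errSq α ν θ' := by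
    rw [W2errSq_eq_add_sq hα hb θ']
    exact le_add_of_nonneg_right (by positivity)
  refine ⟨⟨(avarLeft α ν, avarRight α ν), ⟨hle, fun θ' _ => hmin θ'⟩, ?_⟩,
    hle, fun θ' _ => hmin θ'⟩
  rintro θ ⟨-, hθ⟩
  have hopt := hθ (avarLeft α ν, avarRight α ν) hle
  rw [W2errSq_eq_add_sq hα hb θ, add_le_iff_nonpos_right] at hopt
  have hsq1 : 0 ≤ α * (avarLeft α ν - θ.1) ^ 2 := by positivity
  have hsq2 : 0 ≤ (1 - α) * (avarRight α ν - θ.2) ^ 2 := by positivity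
  have e1 : α * (avarLeft α ν - θ.1) ^ 2 = 0 := by linarith
  have e2 : (1 - α) * (avarRight α ν - θ.2) ^ 2 = 0 := by linarith
  rw [mul_eq_zero_iff_left h0.ne', sq_eq_zero_iff, sub_eq_zero] at e1
  rw [mul_eq_zero_iff_left h1.ne', sq_eq_zero_iff, sub_eq_zero] at e2
  exact Prod.ext e1.symm e2.symm

end
end

section
/- Let 0 < α < 1 and let ν = Σ_{j=1}^M p_j δ_{v_j} be a discrete probability measure with M ≥ 1, p_1,…,p_M ≥ 0, p_1+⋯+p_M = 1 and sorted values v_1 ≤ ⋯ ≤ v_M. Then AVaR^left_α(ν) = (1/α) Σ_{j=1}^M max(0, min(p_j, α − Σ_{j'≤j−1} p_{j'})) · v_j and AVaR^right_{1−α}(ν) = (1/(1−α)) Σ_{j=1}^M max(0, min(p_j, Σ_{j'≤j} p_{j'} − α)) · v_j, with the convention Σ_{j'≤0} p_{j'} = 0. -/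
open MeasureTheory ProbabilityTheory Finset Set

noncomputable section

/-- The discrete measure on `ℝ` with mass `p j` at `v j`. -/
abbrev discreteMeasure {ι : Type*} [Fintype ι] (p v : ι → ℝ) : Measure ℝ :=
  ∑ j, ENNReal.ofReal (p j) • Measure.dirac (v j)

section Discrete

variable {ι : Type*} [Fintype ι]

lemma isProbabilityMeasure_discreteMeasure {p v : ι → ℝ} (hp : ∀ j, 0 ≤ p j)
    (hsum : ∑ j, p j = 1) : IsProbabilityMeasure (discreteMeasure p v) := by
  constructor
  simp only [Measure.coe_finsetSum, Finset.sum_apply, Measure.smul_apply, measure_univ,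
    smul_eq_mul, mul_one]
  rw [← ENNReal.ofReal_sum_of_nonneg fun j _ => hp j, hsum, ENNReal.ofReal_one]

lemma cdf_discreteMeasure {p v : ι → ℝ} (hp : ∀ j, 0 ≤ p j) (hsum : ∑ j, p j = 1) (z : ℝ) :
    cdf (discreteMeasure p v) z = ∑ j ∈ univ.filter (v · ≤ z), p j := by
  have := isProbabilityMeasure_discreteMeasure (v := v) hp hsum
  rw [cdf_eq_real, Measure.real]
  simp only [Measure.coe_finsetSum, Finset.sum_apply, Measure.smul_apply, smul_eq_mul,
    Measure.dirac_apply' _ measurableSet_Iic]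
  rw [ENNReal.toReal_sum, Finset.sum_filter]
  · refine Finset.sum_congr rfl fun j _ => ?_
    by_cases h : v j ≤ z <;> simp [h, ENNReal.toReal_ofReal (hp j)]
  · intro j _
    by_cases h : v j ≤ z <;> simp [h]

variable [LinearOrder ι]

lemma sum_filter_le_eq (p : ι → ℝ) (j : ι) :
    ∑ i ∈ univ.filter (· ≤ j), p i = (∑ i ∈ univ.filter (· < j), p i) + p j := by
  have h : univ.filter (· ≤ j) = insert j (univ.filter (· < j)) := by
    ext i
    simp [le_iff_eq_or_lt]
  rw [h, Finset.sum_insert (by simp), add_comm]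

lemma sum_filter_le_le_sum_filter_lt {p : ι → ℝ} (hp : ∀ j, 0 ≤ p j) {i j : ι} (h : i < j) :
    ∑ k ∈ univ.filter (· ≤ i), p k ≤ ∑ k ∈ univ.filter (· < j), p k := by
  refine Finset.sum_le_sum_of_subset_of_nonneg (fun k hk => ?_) fun k _ _ => hp k
  simp only [Finset.mem_filter, Finset.mem_univ, true_and] at hk ⊢
  exact hk.trans_lt h

lemma exists_mem_Ioc_partialSums {p : ι → ℝ} (hsum : ∑ j, p j = 1) {τ : ℝ}
    (hτ : τ ∈ Set.Ioc (0 : ℝ) 1) :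
    ∃ j, τ ∈ Set.Ioc (∑ i ∈ univ.filter (· < j), p i) (∑ i ∈ univ.filter (· ≤ j), p i) := by
  have hne : (univ : Finset ι).Nonempty := by
    by_contra h
    simp [Finset.not_nonempty_iff_eq_empty.1 h] at hsum
  have hlevel : (univ.filter fun j => τ ≤ ∑ i ∈ univ.filter (· ≤ j), p i).Nonempty := by
    refine ⟨univ.max' hne, ?_⟩
    have h : univ.filter (· ≤ univ.max' hne) = Finset.univ :=
      Finset.filter_true_of_mem fun i hi => Finset.le_max' _ _ hi
    rw [Finset.mem_filter, h, hsum]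
    exact ⟨Finset.mem_univ _, hτ.2⟩
  obtain ⟨j, hj, hmin⟩ := Finset.exists_min_image _ id hlevel
  simp only [Finset.mem_filter, Finset.mem_univ, true_and, id] at hj hmin
  refine ⟨j, ?_, hj⟩
  rcases (univ.filter (· < j)).eq_empty_or_nonempty with h | h
  · simpa [h] using hτ.1
  · obtain ⟨k, hk, hmax⟩ := Finset.exists_max_image _ id h
    simp only [Finset.mem_filter, Finset.mem_univ, true_and, id] at hk hmax
    have heq : univ.filter (· < j) = univ.filter (· ≤ k) := by
      ext i
      simp only [Finset.mem_filter, Finset.mem_univ, true_and]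
      exact ⟨hmax i, fun hi => hi.trans_lt hk⟩
    rw [heq]
    by_contra! hcon
    exact (hmin k hcon).not_gt hk

lemma quantileFn_discreteMeasure_of_mem_Ioc {p v : ι → ℝ} (hp : ∀ j, 0 ≤ p j)
    (hsum : ∑ j, p j = 1) (hv : Monotone v) {τ : ℝ} {j : ι}
    (hτ : τ ∈ Set.Ioc (∑ i ∈ univ.filter (· < j), p i) (∑ i ∈ univ.filter (· ≤ j), p i)) :
    quantileFn (discreteMeasure p v) τ = v j := by
  have h : {z : ℝ | τ ≤ cdf (discreteMeasure p v) z} = Set.Ici (v j) := by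
    ext z
    rw [Set.mem_ofPred_eq, Set.mem_Ici, cdf_discreteMeasure hp hsum]
    constructor
    · intro hz
      by_contra! hlt
      refine (hz.trans (Finset.sum_le_sum_of_subset_of_nonneg (fun i hi => ?_)
        fun i _ _ => hp i)).not_gt hτ.1
      simp only [Finset.mem_filter, Finset.mem_univ, true_and] at hi ⊢
      exact hv.reflect_lt (hi.trans_lt hlt)
    · intro hz
      refine hτ.2.trans (Finset.sum_le_sum_of_subset_of_nonneg (fun i hi => ?_) fun i _ _ => hp i)
      simp only [Finset.mem_filter, Finset.mem_univ, true_and] at hi ⊢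
      exact (hv hi).trans hz
  rw [quantileFn, h, csInf_Ici]

lemma quantileFn_discreteMeasure {p v : ι → ℝ} (hp : ∀ j, 0 ≤ p j) (hsum : ∑ j, p j = 1)
    (hv : Monotone v) {τ : ℝ} (hτ : τ ∈ Set.Ioc (0 : ℝ) 1) :
    quantileFn (discreteMeasure p v) τ = ∑ j,
      (Set.Ioc (∑ i ∈ univ.filter (· < j), p i) (∑ i ∈ univ.filter (· ≤ j), p i)).indicator
        (fun _ => v j) τ := by
  obtain ⟨j, hj⟩ := exists_mem_Ioc_partialSums hsum hτ
  rw [quantileFn_discreteMeasure_of_mem_Ioc hp hsum hv hj, Finset.sum_eq_single j]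
  · rw [Set.indicator_of_mem hj]
  · intro i _ hij
    refine Set.indicator_of_notMem (fun hi => ?_) _
    rcases lt_or_gt_of_ne hij with h | h
    · exact (hi.2.trans (sum_filter_le_le_sum_filter_lt hp h)).not_gt hj.1
    · exact (hj.2.trans (sum_filter_le_le_sum_filter_lt hp h)).not_gt hi.1
  · simp

lemma integral_quantileFn_discreteMeasure {p v : ι → ℝ} (hp : ∀ j, 0 ≤ p j)
    (hsum : ∑ j, p j = 1) (hv : Monotone v) {a b : ℝ} (ha : 0 ≤ a) (hab : a ≤ b) (hb : b ≤ 1) :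
    ∫ τ in a..b, quantileFn (discreteMeasure p v) τ = ∑ j,
      max 0 (min b (∑ i ∈ univ.filter (· ≤ j), p i) -
        max a (∑ i ∈ univ.filter (· < j), p i)) * v j := by
  rw [intervalIntegral.integral_of_le hab, setIntegral_congr_fun measurableSet_Ioc
    fun τ hτ => quantileFn_discreteMeasure hp hsum hv ⟨ha.trans_lt hτ.1, hτ.2.trans hb⟩,
    integral_finsetSum]
  · refine Finset.sum_congr rfl fun j _ => ?_
    rw [setIntegral_indicator measurableSet_Ioc, setIntegral_const, Set.Ioc_inter_Ioc,
      Real.volume_real_Ioc, smul_eq_mul, max_comm]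
  · exact fun j _ => (integrable_const _).indicator measurableSet_Ioc

end Discrete

theorem stmt1 (α : ℝ) (hα : α ∈ Set.Ioo (0:ℝ) 1) (M : ℕ) (hM : 1 ≤ M)
    (p v : Fin M → ℝ) (hp : ∀ j, 0 ≤ p j) (hsum : ∑ j, p j = 1)
    (hv : Monotone v) :
    avarLeft α (∑ j, ENNReal.ofReal (p j) • Measure.dirac (v j)) =
      (1 / α) * ∑ j, max 0 (min (p j) (α - ∑ j' ∈ univ.filter (· < j), p j')) * v j ∧
    avarRight α (∑ j, ENNReal.ofReal (p j) • Measure.dirac (v j)) =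
      (1 / (1 - α)) *
        ∑ j, max 0 (min (p j) ((∑ j' ∈ univ.filter (· ≤ j), p j') - α)) * v j := by
  obtain ⟨h0, h1⟩ := hα
  have hlt_nonneg (j : Fin M) : 0 ≤ ∑ i ∈ univ.filter (· < j), p i :=
    Finset.sum_nonneg fun i _ => hp i
  have hle_one (j : Fin M) : ∑ i ∈ univ.filter (· ≤ j), p i ≤ 1 :=
    hsum ▸ Finset.sum_le_sum_of_subset_of_nonneg (Finset.filter_subset _ _) fun i _ _ => hp i
  constructor
  · rw [avarLeft, integral_quantileFn_discreteMeasure hp hsum hv le_rfl h0.le h1.le]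
    congr 1
    refine Finset.sum_congr rfl fun j _ => ?_
    rw [max_eq_right (hlt_nonneg j), sum_filter_le_eq, ← min_sub_sub_right, add_sub_cancel_left,
      min_comm]
  · rw [avarRight, integral_quantileFn_discreteMeasure hp hsum hv h0.le h1.le le_rfl]
    congr 1
    refine Finset.sum_congr rfl fun j _ => ?_
    rw [min_eq_right (hle_one j), ← min_sub_sub_left, min_comm]
    congr 3
    rw [sum_filter_le_eq, add_sub_cancel_left]

end
end

section
/- Let 0 < α < 1 and let ν = Σ_{j=1}^M p_j δ_{v_j} be a discrete probability measure with M ≥ 1, p_1,…,p_M ≥ 0, p_1+⋯+p_M = 1 and sorted values v_1 ≤ ⋯ ≤ v_M. Writing v = (v_1,…,v_M) and p = (p_1,…,p_M), one has AVaR^left_α(ν) = (1/α) inf_λ ⟨λ, v⟩ and AVaR^right_{1−α}(ν) = (1/(1−α)) sup_λ ⟨p − λ, v⟩, where the infimum and supremum range over all weight vectors λ = (λ_1,…,λ_M) satisfying 0 ≤ λ_i ≤ p_i for all i and Σ_{i=1}^M λ_i = α. -/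
open MeasureTheory ProbabilityTheory Finset Set

noncomputable section

/-- Sum of the weights `p j` with index `j < k`. -/
def partialWeight {M : ℕ} (p : Fin M → ℝ) (k : ℕ) : ℝ :=
  ∑ j ∈ Finset.univ.filter (fun j : Fin M => (j : ℕ) < k), p j

lemma partialWeight_zero {M : ℕ} (p : Fin M → ℝ) : partialWeight p 0 = 0 := by
  simp [partialWeight]

lemma partialWeight_self {M : ℕ} (p : Fin M → ℝ) : partialWeight p M = ∑ j, p j := by
  simp [partialWeight]

lemma partialWeight_succ {M : ℕ} (p : Fin M → ℝ) (i : Fin M) :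
    partialWeight p (i + 1) = partialWeight p i + p i := by
  have h : (Finset.univ.filter fun j : Fin M => (j : ℕ) < i + 1) =
      insert i (Finset.univ.filter fun j : Fin M => (j : ℕ) < i) := by
    ext j
    simp only [Finset.mem_filter, Finset.mem_univ, true_and, Finset.mem_insert, Fin.ext_iff]
    omega
  rw [partialWeight, h, Finset.sum_insert (by simp), add_comm, partialWeight]

lemma partialWeight_mono {M : ℕ} {p : Fin M → ℝ} (hp : ∀ j, 0 ≤ p j) :
    Monotone (partialWeight p) := by
  intro a b hab
  refine Finset.sum_le_sum_of_subset_of_nonneg (fun j hj => ?_) fun j _ _ => hp j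
  simp only [Finset.mem_filter, Finset.mem_univ, true_and] at hj ⊢
  omega

lemma isProbabilityMeasure_sum_dirac {M : ℕ} {p : Fin M → ℝ} (v : Fin M → ℝ)
    (hp : ∀ j, 0 ≤ p j) (hsum : ∑ j, p j = 1) :
    IsProbabilityMeasure (∑ j, ENNReal.ofReal (p j) • Measure.dirac (v j)) := by
  constructor
  simp [← ENNReal.ofReal_sum_of_nonneg fun j _ => hp j, hsum]

lemma cdf_sum_dirac {M : ℕ} {p : Fin M → ℝ} (v : Fin M → ℝ)
    (hp : ∀ j, 0 ≤ p j) (hsum : ∑ j, p j = 1) (z : ℝ) :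
    cdf (∑ j, ENNReal.ofReal (p j) • Measure.dirac (v j)) z = ∑ j with v j ≤ z, p j := by
  have := isProbabilityMeasure_sum_dirac v hp hsum
  rw [cdf_eq_real, Measure.real, Measure.finsetSum_apply, ENNReal.toReal_sum, Finset.sum_filter]
  · refine Finset.sum_congr rfl fun j _ => ?_
    by_cases h : v j ≤ z <;> simp [h, hp j]
  · intro j _
    by_cases h : v j ≤ z <;> simp [h]

lemma quantileFn_sum_dirac {M : ℕ} {p v : Fin M → ℝ} (hp : ∀ j, 0 ≤ p j)
    (hsum : ∑ j, p j = 1) (hv : Monotone v) (i : Fin M) {τ : ℝ}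
    (h₁ : partialWeight p i < τ) (h₂ : τ ≤ partialWeight p (i + 1)) :
    quantileFn (∑ j, ENNReal.ofReal (p j) • Measure.dirac (v j)) τ = v i := by
  refine IsLeast.csInf_eq ⟨?_, fun z hz => ?_⟩
  · rw [Set.mem_ofPred_eq, cdf_sum_dirac v hp hsum]
    refine h₂.trans (Finset.sum_le_sum_of_subset_of_nonneg (fun j hj => ?_) fun j _ _ => hp j)
    simp only [Finset.mem_filter, Finset.mem_univ, true_and] at hj ⊢
    exact hv (Fin.le_def.2 (by omega))
  · rw [Set.mem_ofPred_eq, cdf_sum_dirac v hp hsum] at hz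
    by_contra! hlt
    refine absurd (h₁.trans_le hz) (not_lt.2 ?_)
    refine Finset.sum_le_sum_of_subset_of_nonneg (fun j hj => ?_) fun j _ _ => hp j
    simp only [Finset.mem_filter, Finset.mem_univ, true_and] at hj ⊢
    by_contra! hij
    exact absurd (hv (Fin.le_def.2 hij)) (not_le.2 (hj.trans_lt hlt))

/-- The greedy weights: mass `c` is spent on the indices in increasing order. -/
def greedyWeight {M : ℕ} (p : Fin M → ℝ) (c : ℝ) (i : Fin M) : ℝ :=
  min c (partialWeight p (i + 1)) - min c (partialWeight p i)

lemma greedyWeight_nonneg {M : ℕ} {p : Fin M → ℝ} (hp : ∀ j, 0 ≤ p j) (c : ℝ) (i : Fin M) :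
    0 ≤ greedyWeight p c i :=
  sub_nonneg.2 (min_le_min_left c (partialWeight_mono hp (Nat.le_succ _)))

lemma greedyWeight_le {M : ℕ} {p : Fin M → ℝ} (hp : ∀ j, 0 ≤ p j) (c : ℝ) (i : Fin M) :
    greedyWeight p c i ≤ p i := by
  rw [greedyWeight, partialWeight_succ]
  have := hp i
  rcases min_cases c (partialWeight p i + p i) with h | h <;>
    rcases min_cases c (partialWeight p i) with h' | h' <;> linarith

lemma sum_greedyWeight {M : ℕ} {p : Fin M → ℝ} (hsum : ∑ j, p j = 1) {c : ℝ}
    (h₀ : 0 ≤ c) (h₁ : c ≤ 1) : ∑ i, greedyWeight p c i = c := by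
  have h := Finset.sum_range_sub (fun k => min c (partialWeight p k)) M
  rw [Finset.sum_range] at h
  simpa [greedyWeight, partialWeight_zero, partialWeight_self, hsum, h₀, h₁] using h

lemma greedyWeight_one {M : ℕ} {p : Fin M → ℝ} (hp : ∀ j, 0 ≤ p j) (hsum : ∑ j, p j = 1)
    (i : Fin M) : greedyWeight p 1 i = p i := by
  have h : ∀ k ≤ M, partialWeight p k ≤ 1 := fun k hk =>
    (partialWeight_mono hp hk).trans_eq ((partialWeight_self p).trans hsum)
  rw [greedyWeight, min_eq_right (h _ i.2), min_eq_right (h _ i.2.le), partialWeight_succ]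
  ring

lemma integral_quantileFn_sum_dirac {M : ℕ} {p v : Fin M → ℝ} (hp : ∀ j, 0 ≤ p j)
    (hsum : ∑ j, p j = 1) (hv : Monotone v) {c : ℝ} (h₀ : 0 ≤ c) (h₁ : c ≤ 1) :
    IntervalIntegrable (quantileFn (∑ j, ENNReal.ofReal (p j) • Measure.dirac (v j)))
      volume 0 c ∧
    ∫ τ in (0:ℝ)..c, quantileFn (∑ j, ENNReal.ofReal (p j) • Measure.dirac (v j)) τ =
      ∑ i, greedyWeight p c i * v i := by
  set Q := quantileFn (∑ j, ENNReal.ofReal (p j) • Measure.dirac (v j))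
  set a : ℕ → ℝ := fun k => min c (partialWeight p k) with ha
  have ha₀ : a 0 = 0 := by simp [ha, partialWeight_zero, h₀]
  have haM : a M = c := by simp [ha, partialWeight_self, hsum, h₁]
  have hQ : ∀ i : Fin M, Set.EqOn (fun _ => v i) Q (Set.uIoc (a i) (a (i + 1))) := by
    intro i τ hτ
    rw [Set.uIoc_of_le (min_le_min_left c (partialWeight_mono hp (Nat.le_succ _)))] at hτ
    have hc : τ ≤ c := hτ.2.trans (min_le_left _ _)
    refine (quantileFn_sum_dirac hp hsum hv i ?_ (hτ.2.trans (min_le_right _ _))).symm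
    exact (min_lt_iff.1 hτ.1).resolve_left (not_lt.2 hc)
  have hint : ∀ k < M, IntervalIntegrable Q volume (a k) (a (k + 1)) := fun k hk =>
    (intervalIntegrable_const (c := v ⟨k, hk⟩)).congr (hQ ⟨k, hk⟩)
  have hsumint := intervalIntegral.sum_integral_adjacent_intervals hint
  have htot := IntervalIntegrable.trans_iterate hint
  rw [ha₀, haM] at hsumint htot
  refine ⟨htot, ?_⟩
  rw [← hsumint, Finset.sum_range]
  refine Finset.sum_congr rfl fun i _ => ?_
  rw [← intervalIntegral.integral_congr_ae (ae_of_all _ (hQ i)), intervalIntegral.integral_const, smul_eq_mul]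
  rfl

lemma sum_greedyWeight_mul_le {M : ℕ} {p v : Fin M → ℝ} (hp : ∀ j, 0 ≤ p j)
    (hsum : ∑ j, p j = 1) (hv : Monotone v) {c : ℝ} (h₀ : 0 < c) (h₁ : c ≤ 1)
    {lam : Fin M → ℝ} (hlam : ∀ i, 0 ≤ lam i ∧ lam i ≤ p i) (hlamsum : ∑ i, lam i = c) :
    ∑ i, greedyWeight p c i * v i ≤ ∑ i, lam i * v i := by
  obtain ⟨k, hk₁, hk₂⟩ : ∃ k : Fin M, partialWeight p k < c ∧ c ≤ partialWeight p (k + 1) := by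
    have hex : ∃ n, c ≤ partialWeight p n := ⟨M, by rwa [partialWeight_self, hsum]⟩
    classical
    have hle : Nat.find hex ≤ M := Nat.find_min' hex (by rwa [partialWeight_self, hsum])
    have hspec := Nat.find_spec hex
    obtain ⟨n, hn⟩ : ∃ n, Nat.find hex = n + 1 := by
      refine Nat.exists_eq_succ_of_ne_zero fun h => ?_
      rw [h, partialWeight_zero] at hspec
      exact absurd hspec (not_le.2 h₀)
    rw [hn] at hspec
    exact ⟨⟨n, by omega⟩, not_le.1 (Nat.find_min hex (by rw [hn]; exact n.lt_succ_self)), hspec⟩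
  have hterm : ∀ i, 0 ≤ (lam i - greedyWeight p c i) * (v i - v k) := by
    intro i
    rcases lt_trichotomy i k with hik | rfl | hik
    · have h : partialWeight p (i + 1) ≤ c := (partialWeight_mono hp hik).trans hk₁.le
      have h' : partialWeight p i ≤ c := (partialWeight_mono hp (Nat.le_succ _)).trans h
      refine mul_nonneg_of_nonpos_of_nonpos ?_ (sub_nonpos.2 (hv hik.le))
      rw [greedyWeight, min_eq_right h, min_eq_right h', partialWeight_succ]
      linarith [(hlam i).2]
    · simp
    · have h' : c ≤ partialWeight p i := hk₂.trans (partialWeight_mono hp hik)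
      have h : c ≤ partialWeight p (i + 1) := h'.trans (partialWeight_mono hp (Nat.le_succ _))
      refine mul_nonneg ?_ (sub_nonneg.2 (hv hik.le))
      rw [greedyWeight, min_eq_left h, min_eq_left h']
      linarith [(hlam i).1]
  have hnonneg := Finset.sum_nonneg fun i (_ : i ∈ Finset.univ) => hterm i
  have hexp : ∑ i, (lam i - greedyWeight p c i) * (v i - v k) =
      ∑ i, lam i * v i - ∑ i, greedyWeight p c i * v i -
        (∑ i, lam i - ∑ i, greedyWeight p c i) * v k := by
    rw [← Finset.sum_sub_distrib, ← Finset.sum_sub_distrib, Finset.sum_mul,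
      ← Finset.sum_sub_distrib]
    exact Finset.sum_congr rfl fun i _ => by ring
  rw [hexp, hlamsum, sum_greedyWeight hsum h₀.le h₁] at hnonneg
  linarith

theorem stmt2 (α : ℝ) (hα : α ∈ Set.Ioo (0:ℝ) 1) (M : ℕ) (hM : 1 ≤ M)
    (p v : Fin M → ℝ) (hp : ∀ j, 0 ≤ p j) (hsum : ∑ j, p j = 1)
    (hv : Monotone v) :
    avarLeft α (∑ j, ENNReal.ofReal (p j) • Measure.dirac (v j)) =
      (1 / α) * sInf ((fun lam : Fin M → ℝ => ∑ i, lam i * v i) ''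
        {lam | (∀ i, 0 ≤ lam i ∧ lam i ≤ p i) ∧ ∑ i, lam i = α}) ∧
    avarRight α (∑ j, ENNReal.ofReal (p j) • Measure.dirac (v j)) =
      (1 / (1 - α)) * sSup ((fun lam : Fin M → ℝ => ∑ i, (p i - lam i) * v i) ''
        {lam | (∀ i, 0 ≤ lam i ∧ lam i ≤ p i) ∧ ∑ i, lam i = α}) := by
  obtain ⟨h₀, h₁⟩ := hα
  obtain ⟨hi, hI⟩ := integral_quantileFn_sum_dirac hp hsum hv h₀.le h₁.le
  obtain ⟨hi₁, hI₁⟩ := integral_quantileFn_sum_dirac hp hsum hv zero_le_one le_rfl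
  have hfeas : greedyWeight p α ∈
      {lam : Fin M → ℝ | (∀ i, 0 ≤ lam i ∧ lam i ≤ p i) ∧ ∑ i, lam i = α} :=
    ⟨fun i => ⟨greedyWeight_nonneg hp α i, greedyWeight_le hp α i⟩,
      sum_greedyWeight hsum h₀.le h₁.le⟩
  constructor
  · rw [avarLeft, hI]
    congr 1
    refine Eq.symm (IsLeast.csInf_eq ⟨⟨greedyWeight p α, hfeas, rfl⟩, ?_⟩)
    rintro _ ⟨lam, ⟨hlam, hlamsum⟩, rfl⟩
    exact sum_greedyWeight_mul_le hp hsum hv h₀ h₁.le hlam hlamsum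
  · rw [avarRight, ← intervalIntegral.integral_interval_sub_left hi₁ hi, hI, hI₁]
    simp only [greedyWeight_one hp hsum, sub_mul, Finset.sum_sub_distrib]
    congr 1
    refine Eq.symm (IsGreatest.csSup_eq ⟨⟨greedyWeight p α, hfeas, rfl⟩, ?_⟩)
    rintro _ ⟨lam, ⟨hlam, hlamsum⟩, rfl⟩
    exact sub_le_sub_left (sum_greedyWeight_mul_le hp hsum hv h₀ h₁.le hlam hlamsum) _

end
end
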